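/- arXiv:2309.08080 — 8 statements merged into one kernel-verified Lean document; each statement's English description precedes it below -/
import Mathlib

section
/- Let d ≥ 1, K ⊆ ℝ^d compact, U a compact set, M_b, K₁, M_G, L_G ≥ 0. Let b : K × P(K) × U → ℝ^d satisfy |b(x, μ, α)| ≤ M_b and |b(x, μ, α) − b(y, ν, α)| ≤ K₁(|x − y| + W₂(μ, ν)) for all x, y ∈ K, μ, ν ∈ P(K), α ∈ U. Let Gₙ, G : K → ℝ^d be Borel with |Gₙ(x)|, |G(x)| ≤ M_G for all n and x, and G L_G-Lipschitz. Suppose (μₙ) ⊆ P(K) and μ ∈ P(K) satisfy W₁(μₙ, μ) → 0, W₂(μₙ, μ) → 0, and for every ε > 0, μₙ({x ∈ K : |Gₙ(x) − G(x)| ≥ ε}) → 0. Then sup_{α ∈ U} |∫_K ⟨Gₙ(x), b(x, μₙ, α)⟩ dμₙ(x) − ∫_K ⟨G(x), b(x, μ, α)⟩ dμ(x)| → 0 as n → ∞. -/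
open MeasureTheory

/-- A coupling of `μ` and `ν`: a probability measure on the product whose marginals
are `μ` and `ν` respectively. -/
def IsCoupling {d : ℕ} (μ ν : Measure (EuclideanSpace ℝ (Fin d)))
    (Γ : Measure (EuclideanSpace ℝ (Fin d) × EuclideanSpace ℝ (Fin d))) : Prop :=
  IsProbabilityMeasure Γ ∧ Γ.map Prod.fst = μ ∧ Γ.map Prod.snd = ν

/-- The `L^p`-Wasserstein distance `W_p(μ,ν) = inf_Γ (∫ |x-y|^p dΓ)^(1/p)`, the infimum
running over all couplings `Γ` of `μ` and `ν`. -/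
noncomputable def wasserstein {d : ℕ} (p : ℝ)
    (μ ν : Measure (EuclideanSpace ℝ (Fin d))) : ℝ :=
  sInf { c : ℝ | ∃ Γ : Measure (EuclideanSpace ℝ (Fin d) × EuclideanSpace ℝ (Fin d)),
    IsCoupling μ ν Γ ∧ c = (∫ z, ‖z.1 - z.2‖ ^ p ∂Γ) ^ (1 / p) }

open Filter

open scoped RealInnerProductSpace

theorem wasserstein_nonneg {d : ℕ} (p : ℝ) (μ ν : Measure (EuclideanSpace ℝ (Fin d))) :
    0 ≤ wasserstein p μ ν := by
  refine Real.sInf_nonneg ?_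
  rintro c ⟨Γ, -, rfl⟩
  exact Real.rpow_nonneg (integral_nonneg fun z => Real.rpow_nonneg (norm_nonneg _) _) _

theorem wasserstein_self {d : ℕ} {p : ℝ} (hp : 0 < p) (μ : Measure (EuclideanSpace ℝ (Fin d)))
    [IsProbabilityMeasure μ] : wasserstein p μ μ = 0 := by
  refine le_antisymm (csInf_le ?_ ?_) (wasserstein_nonneg p μ μ)
  · refine ⟨0, ?_⟩
    rintro c ⟨Γ, -, rfl⟩
    exact Real.rpow_nonneg (integral_nonneg fun z => Real.rpow_nonneg (norm_nonneg _) _) _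
  · have hdiag : Measurable fun x : EuclideanSpace ℝ (Fin d) => (x, x) := by fun_prop
    refine ⟨μ.map fun x => (x, x), ⟨?_, ?_, ?_⟩, ?_⟩
    · exact Measure.isProbabilityMeasure_map hdiag.aemeasurable
    · rw [Measure.map_map measurable_fst hdiag]
      exact Measure.map_id
    · rw [Measure.map_map measurable_snd hdiag]
      exact Measure.map_id
    · rw [integral_map hdiag.aemeasurable]
      · simp [Real.zero_rpow hp.ne', hp.ne']
      · exact Measurable.aestronglyMeasurable (by fun_prop)

/-- Easy half of Kantorovich duality for measures carried by a compact set. -/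
theorem abs_integral_sub_le_mul_wasserstein_one {d : ℕ} {K : Set (EuclideanSpace ℝ (Fin d))}
    (hK : IsCompact K) {μ ν : Measure (EuclideanSpace ℝ (Fin d))}
    [IsProbabilityMeasure μ] [IsProbabilityMeasure ν] (hμ : μ Kᶜ = 0) (hν : ν Kᶜ = 0)
    {h : EuclideanSpace ℝ (Fin d) → ℝ} {L : NNReal} (hh : LipschitzOnWith L h K) :
    |∫ x, h x ∂μ - ∫ x, h x ∂ν| ≤ L * wasserstein 1 μ ν := by
  obtain ⟨g, hg, hgh⟩ := hh.extend_real
  have hμK : ∀ᵐ x ∂μ, x ∈ K := hμ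
  have hνK : ∀ᵐ x ∂ν, x ∈ K := hν
  have key : ∀ Γ, IsCoupling μ ν Γ → |∫ x, h x ∂μ - ∫ x, h x ∂ν| ≤ L * ∫ z, ‖z.1 - z.2‖ ∂Γ := by
    rintro Γ ⟨hΓ, h1, h2⟩
    have hΓK : ∀ᵐ z ∂Γ, z ∈ K ×ˢ K := by
      filter_upwards [ae_of_ae_map measurable_fst.aemeasurable (h1 ▸ hμK),
        ae_of_ae_map measurable_snd.aemeasurable (h2 ▸ hνK)] with z hz1 hz2
      exact ⟨hz1, hz2⟩
    have hint : ∀ f : EuclideanSpace ℝ (Fin d) × EuclideanSpace ℝ (Fin d) → ℝ,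
        Continuous f → Integrable f Γ := fun f hf => by
      have := hf.continuousOn.integrableOn_compact (μ := Γ) (hK.prod hK)
      rwa [IntegrableOn, Measure.restrict_eq_self_of_ae_mem hΓK] at this
    have e1 : ∫ x, h x ∂μ = ∫ z, g z.1 ∂Γ := by
      rw [integral_congr_ae (hμK.mono fun x hx => hgh hx), ← h1,
        integral_map measurable_fst.aemeasurable hg.continuous.aestronglyMeasurable]
    have e2 : ∫ x, h x ∂ν = ∫ z, g z.2 ∂Γ := by
      rw [integral_congr_ae (hνK.mono fun x hx => hgh hx), ← h2,
        integral_map measurable_snd.aemeasurable hg.continuous.aestronglyMeasurable]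
    rw [e1, e2, ← integral_sub (hint (fun z => g z.1) (hg.continuous.comp continuous_fst))
      (hint (fun z => g z.2) (hg.continuous.comp continuous_snd)), ← integral_const_mul, ← Real.norm_eq_abs]
    refine norm_integral_le_of_norm_le (hint _ (by fun_prop)) (ae_of_all _ fun z => ?_)
    simpa [dist_eq_norm] using hg.dist_le_mul z.1 z.2
  rw [wasserstein, ← smul_eq_mul, ← Real.sInf_smul_of_nonneg L.coe_nonneg]
  refine le_csInf (Set.Nonempty.smul_set ⟨_, μ.prod ν, ⟨inferInstance, ?_, ?_⟩, rfl⟩) ?_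
  · exact Measure.fst_prod
  · exact Measure.snd_prod
  · rintro _ ⟨_, ⟨Γ, hΓ, rfl⟩, rfl⟩
    simpa using key Γ hΓ

/-- convergence of the drift term of the Hamiltonian, uniformly in the
control `α ∈ U`: with `b` bounded and Lipschitz in `(x, μ)`, `Gₙ, G` bounded Borel
vector fields with `G` Lipschitz, `W₁(μₙ,μ) → 0`, `W₂(μₙ,μ) → 0` and `Gₙ → G` in
`μₙ`-measure, one has
`sup_α |∫_K ⟨Gₙ, b(·, μₙ, α)⟩ dμₙ − ∫_K ⟨G, b(·, μ, α)⟩ dμ| → 0`. -/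
theorem tendstoUniformly_integral_drift {d : ℕ} (hd : 1 ≤ d)
    (K : Set (EuclideanSpace ℝ (Fin d))) (hK : IsCompact K)
    (U : Type) [TopologicalSpace U] [CompactSpace U]
    (Mb K₁ MG : ℝ) (LG : NNReal)
    (b : EuclideanSpace ℝ (Fin d) → Measure (EuclideanSpace ℝ (Fin d)) → U →
      EuclideanSpace ℝ (Fin d))
    (hbbd : ∀ x ∈ K, ∀ (ρ : Measure (EuclideanSpace ℝ (Fin d))),
      IsProbabilityMeasure ρ → ρ Kᶜ = 0 → ∀ α : U, ‖b x ρ α‖ ≤ Mb)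
    (hblip : ∀ x ∈ K, ∀ y ∈ K, ∀ (ρ σ : Measure (EuclideanSpace ℝ (Fin d))),
      IsProbabilityMeasure ρ → IsProbabilityMeasure σ → ρ Kᶜ = 0 → σ Kᶜ = 0 → ∀ α : U,
      ‖b x ρ α - b y σ α‖ ≤ K₁ * (‖x - y‖ + wasserstein 2 ρ σ))
    (G : ℕ → EuclideanSpace ℝ (Fin d) → EuclideanSpace ℝ (Fin d))
    (G' : EuclideanSpace ℝ (Fin d) → EuclideanSpace ℝ (Fin d))
    (hGmeas : ∀ n, Measurable (G n)) (hG'meas : Measurable G')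
    (hGbd : ∀ n, ∀ x ∈ K, ‖G n x‖ ≤ MG) (hG'bd : ∀ x ∈ K, ‖G' x‖ ≤ MG)
    (hG'lip : LipschitzOnWith LG G' K)
    (μ : ℕ → Measure (EuclideanSpace ℝ (Fin d))) (ν : Measure (EuclideanSpace ℝ (Fin d)))
    [∀ n, IsProbabilityMeasure (μ n)] [IsProbabilityMeasure ν]
    (hμK : ∀ n, μ n Kᶜ = 0) (hνK : ν Kᶜ = 0)
    (hW1 : Tendsto (fun n => wasserstein 1 (μ n) ν) atTop (nhds 0))
    (hW2 : Tendsto (fun n => wasserstein 2 (μ n) ν) atTop (nhds 0))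
    (hGconv : ∀ ε > (0 : ℝ),
      Tendsto (fun n => μ n {x ∈ K | ε ≤ ‖G n x - G' x‖}) atTop (nhds 0)) :
    TendstoUniformly (fun n (α : U) => ∫ x in K, ⟪G n x, b x (μ n) α⟫ ∂(μ n))
      (fun α => ∫ x in K, ⟪G' x, b x ν α⟫ ∂ν) atTop := by
  have hE : ∀ x y : EuclideanSpace ℝ (Fin d), |⟪x, y⟫| ≤ ‖x‖ * ‖y‖ := abs_real_inner_le_norm
  obtain ⟨x₀, hx₀⟩ : K.Nonempty := by
    by_contra hne
    rw [Set.not_nonempty_iff_eq_empty.mp hne] at hνK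
    simp at hνK
  have hMG : 0 ≤ MG := (norm_nonneg _).trans (hG'bd x₀ hx₀)
  have hbbd' : ∀ x ∈ K, ∀ ρ : Measure (EuclideanSpace ℝ (Fin d)), IsProbabilityMeasure ρ →
      ρ Kᶜ = 0 → ∀ α, ‖b x ρ α‖ ≤ |Mb| := fun x hx ρ hρ hρK α =>
    (hbbd x hx ρ hρ hρK α).trans (le_abs_self _)
  have hbx : ∀ ρ : Measure (EuclideanSpace ℝ (Fin d)), IsProbabilityMeasure ρ → ρ Kᶜ = 0 →
      ∀ α, ∀ x ∈ K, ∀ y ∈ K, ‖b x ρ α - b y ρ α‖ ≤ |K₁| * ‖x - y‖ := by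
    intro ρ hρ hρK α x hx y hy
    have h := hblip x hx y hy ρ ρ hρ hρ hρK hρK α
    rw [wasserstein_self two_pos, add_zero] at h
    exact h.trans (by gcongr; exact le_abs_self _)
  have hbcont : ∀ ρ : Measure (EuclideanSpace ℝ (Fin d)), IsProbabilityMeasure ρ → ρ Kᶜ = 0 →
      ∀ α, ContinuousOn (fun x => b x ρ α) K := by
    intro ρ hρ hρK α
    refine (LipschitzOnWith.of_dist_le_mul (K := ‖K₁‖₊) fun x hx y hy => ?_).continuousOn
    simpa [dist_eq_norm] using hbx ρ hρ hρK α x hx y hy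
  have hμres : ∀ n, (μ n).restrict K = μ n := fun n => Measure.restrict_eq_self_of_ae_mem (hμK n)
  have hνres : ν.restrict K = ν := Measure.restrict_eq_self_of_ae_mem hνK
  set L : NNReal := LG * ‖Mb‖₊ + MG.toNNReal * ‖K₁‖₊ with hL
  have hlip : ∀ α, LipschitzOnWith L (fun x => ⟪G' x, b x ν α⟫) K := by
    intro α
    refine LipschitzOnWith.of_dist_le_mul fun x hx y hy => ?_
    have e : ⟪G' x, b x ν α⟫ - ⟪G' y, b y ν α⟫
        = ⟪G' x - G' y, b x ν α⟫ + ⟪G' y, b x ν α - b y ν α⟫ := by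
      rw [inner_sub_left, inner_sub_right]; ring
    have hG := hG'lip.dist_le_mul x hx y hy
    rw [dist_eq_norm, dist_eq_norm] at hG
    rw [Real.dist_eq, e, dist_eq_norm]
    calc _ ≤ ‖G' x - G' y‖ * ‖b x ν α‖ + ‖G' y‖ * ‖b x ν α - b y ν α‖ :=
          (abs_add_le _ _).trans (add_le_add (hE _ _) (hE _ _))
      _ ≤ (LG * ‖x - y‖) * |Mb| + MG * (|K₁| * ‖x - y‖) := by
          gcongr
          · exact hbbd' x hx ν inferInstance hνK α
          · exact hG'bd y hy
          · exact hbx ν inferInstance hνK α x hx y hy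
      _ = L * ‖x - y‖ := by
          rw [hL]; push_cast; rw [Real.coe_toNNReal _ hMG, Real.norm_eq_abs, Real.norm_eq_abs]; ring
  rw [Metric.tendstoUniformly_iff]
  intro ε hε
  obtain ⟨δ, hδ, hδε⟩ : ∃ δ > 0, |Mb| * δ < ε / 2 := by
    refine ⟨ε / (2 * (|Mb| + 1)), by positivity, ?_⟩
    rw [mul_div_assoc', div_lt_div_iff₀ (by positivity) two_pos]
    nlinarith [abs_nonneg Mb]
  set S : ℕ → Set (EuclideanSpace ℝ (Fin d)) := fun n => {x ∈ K | δ ≤ ‖G n x - G' x‖} with hS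
  have hSmeas : ∀ n, MeasurableSet (S n) := fun n =>
    hK.measurableSet.inter (measurableSet_le measurable_const ((hGmeas n).sub hG'meas).norm)
  have hSlim : Tendsto (fun n => (μ n).real (S n)) atTop (nhds 0) := by
    exact (ENNReal.tendsto_toReal ENNReal.zero_ne_top).comp (hGconv δ hδ)
  have hlim : Tendsto (fun n => |Mb| * (2 * MG) * (μ n).real (S n)
      + MG * |K₁| * wasserstein 2 (μ n) ν + L * wasserstein 1 (μ n) ν) atTop (nhds 0) := by
    simpa using ((hSlim.const_mul (|Mb| * (2 * MG))).add (hW2.const_mul (MG * |K₁|))).add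
      (hW1.const_mul (L : ℝ))
  filter_upwards [hlim.eventually_lt_const (half_pos hε)] with n hn α
  have hKae : ∀ᵐ x ∂(μ n), x ∈ K := hμK n
  rw [hμres, hνres, dist_comm, Real.dist_eq]
  have hH : Integrable (fun x => ⟪G' x, b x ν α⟫) (μ n) := by
    have := (hlip α).continuousOn.integrableOn_compact (μ := μ n) hK
    rwa [IntegrableOn, hμres] at this
  have hF : Integrable (fun x => ⟪G n x, b x (μ n) α⟫) (μ n) := by
    have hbm := (hbcont (μ n) inferInstance (hμK n) α).aestronglyMeasurable (μ := μ n)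
      hK.measurableSet
    rw [hμres] at hbm
    refine Integrable.of_bound ((hGmeas n).aestronglyMeasurable.inner hbm) (MG * |Mb|) ?_
    filter_upwards [hKae] with x hx
    refine (hE _ _).trans ?_
    gcongr
    · exact hGbd n x hx
    · exact hbbd' x hx (μ n) inferInstance (hμK n) α
  have hbound : |∫ x, ⟪G n x, b x (μ n) α⟫ ∂(μ n) - ∫ x, ⟪G' x, b x ν α⟫ ∂(μ n)|
      ≤ |Mb| * δ + |Mb| * (2 * MG) * (μ n).real (S n) + MG * |K₁| * wasserstein 2 (μ n) ν := by
    have hind : Integrable ((S n).indicator fun _ => |Mb| * (2 * MG)) (μ n) :=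
      (integrable_const _).indicator (hSmeas n)
    have hval : ∫ x, (|Mb| * δ + MG * |K₁| * wasserstein 2 (μ n) ν)
          + (S n).indicator (fun _ => |Mb| * (2 * MG)) x ∂(μ n)
        = |Mb| * δ + |Mb| * (2 * MG) * (μ n).real (S n) + MG * |K₁| * wasserstein 2 (μ n) ν := by
      rw [integral_add (integrable_const _) hind, integral_indicator_const _ (hSmeas n)]
      simp
      ring
    rw [← integral_sub hF hH, ← hval, ← Real.norm_eq_abs]
    refine norm_integral_le_of_norm_le ((integrable_const _).add hind) ?_
    filter_upwards [hKae] with x hx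
    have e : ⟪G n x, b x (μ n) α⟫ - ⟪G' x, b x ν α⟫
        = ⟪G n x - G' x, b x (μ n) α⟫ + ⟪G' x, b x (μ n) α - b x ν α⟫ := by
      rw [inner_sub_left, inner_sub_right]; ring
    have h1 : ‖G n x - G' x‖ * |Mb| ≤ |Mb| * δ + (S n).indicator (fun _ => |Mb| * (2 * MG)) x := by
      by_cases hxS : x ∈ S n
      · rw [Set.indicator_of_mem hxS]
        have : ‖G n x - G' x‖ ≤ 2 * MG := by
          linarith [norm_sub_le (G n x) (G' x), hGbd n x hx, hG'bd x hx]
        nlinarith [abs_nonneg Mb]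
      · rw [Set.indicator_of_notMem hxS]
        have : ‖G n x - G' x‖ ≤ δ := le_of_not_ge fun h => hxS ⟨hx, h⟩
        nlinarith [abs_nonneg Mb]
    have h2 : ‖b x (μ n) α - b x ν α‖ ≤ |K₁| * wasserstein 2 (μ n) ν := by
      have h := hblip x hx x hx (μ n) ν inferInstance inferInstance (hμK n) hνK α
      rw [sub_self, norm_zero, zero_add] at h
      exact h.trans (mul_le_mul_of_nonneg_right (le_abs_self _) (wasserstein_nonneg _ _ _))
    rw [Real.norm_eq_abs, e]
    calc _ ≤ ‖G n x - G' x‖ * ‖b x (μ n) α‖ + ‖G' x‖ * ‖b x (μ n) α - b x ν α‖ :=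
          (abs_add_le _ _).trans (add_le_add (hE _ _) (hE _ _))
      _ ≤ ‖G n x - G' x‖ * |Mb| + MG * (|K₁| * wasserstein 2 (μ n) ν) := by
          gcongr
          · exact hbbd' x hx (μ n) inferInstance (hμK n) α
          · exact hG'bd x hx
      _ ≤ _ := by linarith
  have hdual := abs_integral_sub_le_mul_wasserstein_one hK (hμK n) hνK (hlip α)
  have htri := abs_sub_le (∫ x, ⟪G n x, b x (μ n) α⟫ ∂(μ n)) (∫ x, ⟪G' x, b x ν α⟫ ∂(μ n))
    (∫ x, ⟪G' x, b x ν α⟫ ∂ν)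
  linarith
end

section
/- Let d ≥ 1, K ⊆ ℝ^d compact, M ≥ 0, hₙ, h : K → ℝ Borel with |hₙ(x)|, |h(x)| ≤ M for all n and x, and h continuous. Suppose probability measures μₙ on K converge weakly to a probability measure μ on K, and for every ε > 0, μₙ({x ∈ K : |hₙ(x) − h(x)| ≥ ε}) → 0 as n → ∞. Then ∫_K hₙ dμₙ → ∫_K h dμ. -/
open MeasureTheory

open Filter

/-- A function bounded by `C` on `s` has integral over `s` at most `ε` plus `C` times the measure
of the part of `s` where it exceeds `ε`, for a measure of total mass at most one. -/
theorem norm_setIntegral_le_add_mul_measureReal {α : Type*} [MeasurableSpace α] {p : Measure α}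
    [IsZeroOrProbabilityMeasure p] {s : Set α} (hs : MeasurableSet s) {g : α → ℝ}
    (hg : Measurable g) {C ε : ℝ} (hε : 0 ≤ ε) (hC : ∀ x ∈ s, |g x| ≤ C) :
    ‖∫ x in s, g x ∂p‖ ≤ ε + C * p.real {x ∈ s | ε ≤ |g x|} := by
  have hS : MeasurableSet {x ∈ s | ε ≤ |g x|} :=
    hs.inter (measurableSet_le measurable_const hg.abs)
  have hint : Integrable ({x ∈ s | ε ≤ |g x|}.indicator fun _ => C) (p.restrict s) :=
    (integrable_const C).indicator hS
  calc ‖∫ x in s, g x ∂p‖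
      ≤ ∫ x in s, (ε + {x ∈ s | ε ≤ |g x|}.indicator (fun _ => C) x) ∂p := by
        refine norm_integral_le_of_norm_le ((integrable_const ε).add hint) ?_
        filter_upwards [ae_restrict_mem hs] with x hx
        rw [Real.norm_eq_abs]
        by_cases hxε : ε ≤ |g x|
        · rw [Set.indicator_of_mem (show x ∈ {x ∈ s | ε ≤ |g x|} from ⟨hx, hxε⟩)]
          linarith [hC x hx]
        · rw [Set.indicator_of_notMem (fun hmem => hxε hmem.2)]
          linarith
    _ = p.real s * ε + C * p.real {x ∈ s | ε ≤ |g x|} := by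
        rw [integral_add (integrable_const ε) hint, integral_indicator_const C hS,
          setIntegral_const, measureReal_restrict_apply hS,
          Set.inter_eq_left.2 (Set.sep_subset _ _), smul_eq_mul, smul_eq_mul, mul_comm C]
    _ ≤ ε + C * p.real {x ∈ s | ε ≤ |g x|} := by
        gcongr
        exact mul_le_of_le_one_left hε measureReal_le_one

/-- if `hₙ, h` are Borel, uniformly bounded by `M`, `h` is continuous,
`μₙ → μ` weakly on the compact set `K`, and `hₙ → h` in `μₙ`-measure, then
`∫_K hₙ dμₙ → ∫_K h dμ`. -/
theorem tendsto_integral_of_convergence_in_measure {d : ℕ} (hd : 1 ≤ d)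
    (K : Set (EuclideanSpace ℝ (Fin d))) (hK : IsCompact K)
    (M : ℝ)
    (h : ℕ → EuclideanSpace ℝ (Fin d) → ℝ) (h' : EuclideanSpace ℝ (Fin d) → ℝ)
    (hmeas : ∀ n, Measurable (h n)) (h'meas : Measurable h')
    (hbd : ∀ n, ∀ x ∈ K, |h n x| ≤ M) (h'bd : ∀ x ∈ K, |h' x| ≤ M)
    (h'cont : ContinuousOn h' K)
    (μ : ℕ → Measure (EuclideanSpace ℝ (Fin d))) (ν : Measure (EuclideanSpace ℝ (Fin d)))
    [∀ n, IsProbabilityMeasure (μ n)] [IsProbabilityMeasure ν]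
    (hμK : ∀ n, μ n Kᶜ = 0) (hνK : ν Kᶜ = 0)
    (hweak : ∀ f : EuclideanSpace ℝ (Fin d) → ℝ, ContinuousOn f K →
      Tendsto (fun n => ∫ x in K, f x ∂(μ n)) atTop (nhds (∫ x in K, f x ∂ν)))
    (hconv : ∀ ε > (0 : ℝ),
      Tendsto (fun n => μ n {x ∈ K | ε ≤ |h n x - h' x|}) atTop (nhds 0)) :
    Tendsto (fun n => ∫ x in K, h n x ∂(μ n)) atTop (nhds (∫ x in K, h' x ∂ν)) := by
  have hKm : MeasurableSet K := hK.measurableSet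
  have hint : ∀ (p : Measure (EuclideanSpace ℝ (Fin d))) [IsProbabilityMeasure p]
      (g : EuclideanSpace ℝ (Fin d) → ℝ), Measurable g → (∀ x ∈ K, |g x| ≤ M) →
      IntegrableOn g K p := fun p _ g hg hb =>
    Integrable.of_bound hg.aestronglyMeasurable M ((ae_restrict_mem hKm).mono hb)
  have hdiff : Tendsto (fun n => ∫ x in K, (h n x - h' x) ∂(μ n)) atTop (nhds 0) := by
    rw [Metric.tendsto_nhds]
    intro ε hε
    have hreal : Tendsto (fun n => ε / 2 + (M + M) *
        (μ n).real {x ∈ K | ε / 2 ≤ |h n x - h' x|}) atTop (nhds (ε / 2 + (M + M) * 0)) :=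
      (((ENNReal.tendsto_toReal ENNReal.zero_ne_top).comp
        (hconv (ε / 2) (half_pos hε))).const_mul (M + M)).const_add (ε / 2)
    filter_upwards [hreal.eventually_lt_const (show ε / 2 + (M + M) * 0 < ε by linarith)]
      with n hn
    rw [dist_zero_right]
    refine lt_of_le_of_lt (norm_setIntegral_le_add_mul_measureReal hKm
      ((hmeas n).sub h'meas) (half_pos hε).le fun x hx => ?_) hn
    exact (abs_sub _ _).trans (add_le_add (hbd n x hx) (h'bd x hx))
  have hsum := hdiff.add (hweak h' h'cont)
  rw [zero_add] at hsum
  refine hsum.congr fun n => ?_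
  rw [integral_sub (hint _ _ (hmeas n) (hbd n)) (hint _ _ h'meas h'bd), sub_add_cancel]
end

section
/- Let d ≥ 1, K ⊆ ℝ^d compact, κ₁, κ₂, t > 0, μ₀ a probability measure on K, and p : K × K → [0, ∞) Borel with ∫_K p(y, x) dx = 1 for every y ∈ K and p(y, x) ≤ κ₁ t^{−d/2} exp(−κ₂|x − y|²/t) for all x, y ∈ K. Let μ_t be the probability measure on K with Lebesgue density x ↦ ∫_K p(y, x) dμ₀(y). Then for every 1-Lipschitz h : ℝ^d → ℝ, |∫_K h dμ_t − ∫_K h dμ₀| ≤ κ₁ √t ∫_{ℝ^d} |z| exp(−κ₂|z|²) dz. -/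
open MeasureTheory

/-- `‖z‖ * exp (-b * ‖z‖ ^ 2)` is integrable for `b > 0`. -/
theorem integrable_norm_mul_exp_neg_mul_sq_norm {d : ℕ} {b : ℝ} (hb : 0 < b) :
    Integrable (fun z : EuclideanSpace ℝ (Fin d) => ‖z‖ * Real.exp (-b * ‖z‖ ^ 2)) := by
  have hg : Integrable (fun z : EuclideanSpace ℝ (Fin d) => Real.exp (-(b / 2) * ‖z‖ ^ 2)) := by
    have := (GaussianFourier.integrable_cexp_neg_mul_sq_norm_add (V := EuclideanSpace ℝ (Fin d))
      (b := ((b / 2 : ℝ) : ℂ)) (by simpa using hb) 0 0).norm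
    refine this.congr (Filter.Eventually.of_forall fun z => ?_)
    simp only [Complex.norm_exp]
    congr 1
    simp [← Complex.ofReal_pow]
  refine (hg.const_mul (1 + 2 / b)).mono' (by fun_prop) (Filter.Eventually.of_forall fun z => ?_)
  rw [Real.norm_of_nonneg (by positivity)]
  have h1 : ‖z‖ ≤ (1 + 2 / b) * Real.exp (b / 2 * ‖z‖ ^ 2) := by
    have h2 := Real.add_one_le_exp (b / 2 * ‖z‖ ^ 2)
    have h3 : ‖z‖ ≤ (1 + 2 / b) * (b / 2 * ‖z‖ ^ 2 + 1) := by
      have e : (1 + 2 / b) * (b / 2 * ‖z‖ ^ 2 + 1)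
          = 1 + ‖z‖ ^ 2 + (b / 2 * ‖z‖ ^ 2 + 2 / b) := by field_simp; ring
      have : 0 ≤ b / 2 * ‖z‖ ^ 2 + 2 / b := by positivity
      nlinarith [sq_nonneg (‖z‖ - 1)]
    exact h3.trans (by gcongr)
  calc ‖z‖ * Real.exp (-b * ‖z‖ ^ 2)
      ≤ (1 + 2 / b) * Real.exp (b / 2 * ‖z‖ ^ 2) * Real.exp (-b * ‖z‖ ^ 2) := by gcongr
    _ = (1 + 2 / b) * Real.exp (-(b / 2) * ‖z‖ ^ 2) := by
      rw [mul_assoc, ← Real.exp_add]; ring_nf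

/-- The heat kernel bound times the norm, written through the rescaled profile. -/
theorem heat_bound_mul_norm_eq (d : ℕ) {E : Type*} [NormedAddCommGroup E] [NormedSpace ℝ E]
    (κ₁ κ₂ : ℝ) {t : ℝ} (ht : 0 < t) (z : E) :
    κ₁ * t ^ (-(d : ℝ) / 2) * Real.exp (-κ₂ * ‖z‖ ^ 2 / t) * ‖z‖ =
      κ₁ * t ^ (-(d : ℝ) / 2) * √t *
        (‖(√t)⁻¹ • z‖ * Real.exp (-κ₂ * ‖(√t)⁻¹ • z‖ ^ 2)) := by
  have hs : 0 < √t := Real.sqrt_pos.2 ht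
  rw [norm_smul, norm_inv, Real.norm_of_nonneg hs.le, mul_pow, inv_pow, Real.sq_sqrt ht.le]
  have e : -κ₂ * (t⁻¹ * ‖z‖ ^ 2) = -κ₂ * ‖z‖ ^ 2 / t := by field_simp
  rw [e]
  field_simp

/-- The heat kernel bound times the norm is integrable. -/
theorem integrable_heat_bound_mul_norm {d : ℕ} (κ₁ : ℝ) {κ₂ t : ℝ} (hκ₂ : 0 < κ₂) (ht : 0 < t) :
    Integrable (fun z : EuclideanSpace ℝ (Fin d) =>
      κ₁ * t ^ (-(d : ℝ) / 2) * Real.exp (-κ₂ * ‖z‖ ^ 2 / t) * ‖z‖) := by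
  simp_rw [heat_bound_mul_norm_eq d κ₁ κ₂ ht]
  exact ((integrable_norm_mul_exp_neg_mul_sq_norm hκ₂).comp_smul
    (inv_ne_zero (Real.sqrt_pos.2 ht).ne')).const_mul _

/-- The first absolute moment of the heat kernel bound at time `t` scales like `√t`. -/
theorem integral_heat_bound_mul_norm {d : ℕ} (κ₁ κ₂ : ℝ) {t : ℝ} (ht : 0 < t) :
    ∫ z : EuclideanSpace ℝ (Fin d),
        κ₁ * t ^ (-(d : ℝ) / 2) * Real.exp (-κ₂ * ‖z‖ ^ 2 / t) * ‖z‖ =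
      κ₁ * √t * ∫ z : EuclideanSpace ℝ (Fin d), ‖z‖ * Real.exp (-κ₂ * ‖z‖ ^ 2) := by
  have hs : 0 < √t := Real.sqrt_pos.2 ht
  simp_rw [heat_bound_mul_norm_eq d κ₁ κ₂ ht]
  rw [integral_const_mul, Measure.integral_comp_smul volume
    (fun z : EuclideanSpace ℝ (Fin d) => ‖z‖ * Real.exp (-κ₂ * ‖z‖ ^ 2)),
    finrank_euclideanSpace_fin, abs_of_pos (by positivity), inv_pow, inv_inv]
  have e : t ^ (-(d : ℝ) / 2) * √t ^ d = 1 := by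
    rw [Real.sqrt_eq_rpow, ← Real.rpow_natCast, ← Real.rpow_mul ht.le, ← Real.rpow_add ht]
    ring_nf
    simp
  rw [smul_eq_mul]
  linear_combination (κ₁ * √t * ∫ z : EuclideanSpace ℝ (Fin d), ‖z‖ * Real.exp (-κ₂ * ‖z‖ ^ 2)) * e

/-- if the transition kernel `p` satisfies the Gaussian upper bound with
parameters `κ₁, κ₂, t`, and `μt` has Lebesgue density `x ↦ ∫ p(y, x) dμ₀(y)` on `K`,
then for every 1-Lipschitz `h`,
`|∫_K h dμt − ∫_K h dμ₀| ≤ κ₁ √t ∫ |z| exp(−κ₂|z|²) dz`. -/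
theorem integral_lipschitz_kernel_estimate {d : ℕ} (hd : 1 ≤ d)
    (K : Set (EuclideanSpace ℝ (Fin d))) (hK : IsCompact K)
    (κ₁ κ₂ t : ℝ) (hκ₁ : 0 < κ₁) (hκ₂ : 0 < κ₂) (ht : 0 < t)
    (μ₀ : Measure (EuclideanSpace ℝ (Fin d))) [IsProbabilityMeasure μ₀] (hμ₀K : μ₀ Kᶜ = 0)
    (p : EuclideanSpace ℝ (Fin d) → EuclideanSpace ℝ (Fin d) → ℝ)
    (hpmeas : Measurable (Function.uncurry p)) (hpnn : ∀ y x, 0 ≤ p y x)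
    (hpint : ∀ y ∈ K, ∫ x in K, p y x = 1)
    (hpbd : ∀ y ∈ K, ∀ x ∈ K,
      p y x ≤ κ₁ * t ^ (-(d : ℝ) / 2) * Real.exp (-κ₂ * ‖x - y‖ ^ 2 / t))
    (μt : Measure (EuclideanSpace ℝ (Fin d))) [IsProbabilityMeasure μt]
    (hμt : μt = (volume.restrict K).withDensity
      (fun x => ENNReal.ofReal (∫ y in K, p y x ∂μ₀)))
    (h : EuclideanSpace ℝ (Fin d) → ℝ) (hLip : LipschitzWith 1 h) :
    |(∫ x in K, h x ∂μt) - ∫ x in K, h x ∂μ₀| ≤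
      κ₁ * Real.sqrt t *
        ∫ z : EuclideanSpace ℝ (Fin d), ‖z‖ * Real.exp (-κ₂ * ‖z‖ ^ 2) := by
  have hKm : MeasurableSet K := hK.measurableSet
  have hm : μ₀.restrict K = μ₀ := Measure.restrict_eq_self_of_ae_mem (by
    rw [Filter.Eventually, mem_ae_iff]; exact hμ₀K)
  have hmK : ∀ᵐ y ∂μ₀, y ∈ K := by rw [Filter.Eventually, mem_ae_iff]; exact hμ₀K
  have : IsFiniteMeasure (volume.restrict K : Measure (EuclideanSpace ℝ (Fin d))) :=
    isFiniteMeasure_restrict.2 hK.measure_lt_top.ne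
  have hνK : ∀ᵐ x ∂(volume.restrict K), x ∈ K := ae_restrict_mem hKm
  have hprod : ∀ᵐ q ∂(μ₀.prod (volume.restrict K)), q.1 ∈ K ∧ q.2 ∈ K :=
    (Measure.quasiMeasurePreserving_fst.ae hmK).and (Measure.quasiMeasurePreserving_snd.ae hνK)
  set A : ℝ := κ₁ * t ^ (-(d : ℝ) / 2)
  have hA0 : 0 ≤ A := by positivity
  have hpA : ∀ y ∈ K, ∀ x ∈ K, p y x ≤ A := fun y hy x hx =>
    (hpbd y hy x hx).trans (mul_le_of_le_one_right hA0 (Real.exp_le_one_iff.2 (by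
      rw [neg_mul, neg_div]
      exact neg_nonpos.2 (by positivity))))
  obtain ⟨B, hB⟩ := hK.exists_bound_of_continuousOn hLip.continuous.continuousOn
  have hhm : Measurable h := hLip.continuous.measurable
  have hpy : ∀ y, Measurable (p y) := fun y => hpmeas.comp measurable_prodMk_left
  have hbound : ∀ y ∈ K, ∀ x ∈ K, ∀ w ∈ K, ‖p y x * h w‖ ≤ A * B := fun y hy x hx w hw => by
    rw [norm_mul, Real.norm_of_nonneg (hpnn y x)]
    exact mul_le_mul (hpA y hy x hx) (hB w hw) (norm_nonneg _) hA0
  have hint₂ : Integrable (fun q : _ × _ => p q.1 q.2 * h q.2) (μ₀.prod (volume.restrict K)) :=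
    .of_bound (hpmeas.mul (hhm.comp measurable_snd)).aestronglyMeasurable (A * B)
      (hprod.mono fun q hq => hbound _ hq.1 _ hq.2 _ hq.2)
  have hint₁ : ∀ y ∈ K, ∀ c, Integrable (fun x => p y x * c) (volume.restrict K) := fun y hy c =>
    (Integrable.of_bound (hpy y).aestronglyMeasurable A (hνK.mono fun x hx => by
      rw [Real.norm_of_nonneg (hpnn y x)]; exact hpA y hy x hx)).mul_const c
  have hint₃ : ∀ y ∈ K, Integrable (fun x => p y x * h x) (volume.restrict K) := fun y hy =>
    .of_bound ((hpy y).mul hhm).aestronglyMeasurable (A * B)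
      (hνK.mono fun x hx => hbound y hy x hx x hx)
  have hdens : Measurable fun x => ∫ y, p y x ∂μ₀ :=
    (hpmeas.stronglyMeasurable.integral_prod_left').measurable
  have hleft : ∫ x in K, h x ∂μt = ∫ y, (∫ x in K, p y x * h x) ∂μ₀ := by
    have hr : μt.restrict K = μt := by
      rw [hμt, restrict_withDensity hKm, Measure.restrict_restrict hKm, Set.inter_self]
    rw [hr, hμt, hm, integral_withDensity_eq_integral_toReal_smul hdens.ennreal_ofReal
      (Filter.Eventually.of_forall fun _ => ENNReal.ofReal_lt_top), integral_integral_swap hint₂]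
    refine integral_congr_ae (Filter.Eventually.of_forall fun x => ?_)
    simp only [smul_eq_mul]
    rw [ENNReal.toReal_ofReal (integral_nonneg fun y => hpnn y x), integral_mul_const]
  have hhint : Integrable h μ₀ :=
    .of_bound hhm.aestronglyMeasurable B (hmK.mono hB)
  rw [hleft, hm, ← integral_sub hint₂.integral_prod_left hhint, ← Real.norm_eq_abs]
  refine (norm_integral_le_of_norm_le_const (hmK.mono fun y hy => ?_)).trans_eq
    (by rw [probReal_univ, mul_one])
  have hG := integrable_heat_bound_mul_norm (d := d) κ₁ hκ₂ ht
  have hG' := hG.comp_sub_right y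
  rw [← integral_heat_bound_mul_norm κ₁ κ₂ ht,
    ← integral_sub_right_eq_self (fun z : EuclideanSpace ℝ (Fin d) =>
      κ₁ * t ^ (-(d : ℝ) / 2) * Real.exp (-κ₂ * ‖z‖ ^ 2 / t) * ‖z‖) y]
  have e : h y = ∫ x in K, p y x * h y := by rw [integral_mul_const, hpint y hy, one_mul]
  simp only
  rw [e, ← integral_sub (hint₃ y hy) (hint₁ y hy _)]
  refine (norm_integral_le_of_norm_le hG'.integrableOn (hνK.mono fun x hx => ?_)).trans
    (setIntegral_le_integral hG' (Filter.Eventually.of_forall fun x => ?_))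
  · rw [← mul_sub, norm_mul, Real.norm_of_nonneg (hpnn y x)]
    exact mul_le_mul (hpbd y hy x hx) (by simpa using hLip.norm_sub_le x y)
      (norm_nonneg _) (by positivity)
  · simp only [Pi.zero_apply]
    positivity
end

section
/- Let d ≥ 1, K ⊆ ℝ^d compact, and let K₁ := {x ∈ ℝ^d : dist(x, K) ≤ 1}. For each multi-index n with |n| ≥ 1 let f_n : ℝ^d → ℝ be continuously differentiable and c_n ≥ 0, and suppose Σ_n c_n · sup_{x ∈ K₁} (f_n(x)² + |∇f_n(x)|²) < ∞. Let μ be a probability measure on K and v : K → ℝ^d Borel with sup_{x ∈ K} |v(x)| ≤ 1. Then the function ε ↦ Σ_n c_n (∫_K f_n(x + ε v(x)) dμ(x))² is differentiable at ε = 0 with derivative Σ_n 2 c_n (∫_K f_n(x) dμ(x)) (∫_K ⟨∇f_n(x), v(x)⟩ dμ(x)). -/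
open MeasureTheory

open scoped RealInnerProductSpace

section DisplacedIntegral

variable {E : Type*} [NormedAddCommGroup E] [InnerProductSpace ℝ E]
  {f : E → ℝ} {v : E → E} {K : Set E} {C t : ℝ}

theorem add_smul_mem_cthickening_one {x : E} (hx : x ∈ K) (hv : ‖v x‖ ≤ 1) (ht : |t| ≤ 1) :
    x + t • v x ∈ Metric.cthickening 1 K := by
  refine Metric.mem_cthickening_of_dist_le _ x _ _ hx ?_
  rw [dist_self_add_left, norm_smul, Real.norm_eq_abs]
  exact mul_le_one₀ ht (norm_nonneg _) hv

variable [CompleteSpace E]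

theorem ContDiff.continuous_gradient (hf : ContDiff ℝ 1 f) : Continuous (gradient f) :=
  (InnerProductSpace.toDual ℝ E).symm.continuous.comp (hf.continuous_fderiv one_ne_zero)

theorem norm_inner_gradient_add_smul_le
    (hC : ∀ y ∈ Metric.cthickening 1 K, ‖gradient f y‖ ≤ C) (hv : ∀ x ∈ K, ‖v x‖ ≤ 1)
    (ht : |t| ≤ 1) {x : E} (hx : x ∈ K) :
    ‖⟪gradient f (x + t • v x), v x⟫‖ ≤ C := by
  have h := hC _ (add_smul_mem_cthickening_one hx (hv x hx) ht)
  calc ‖⟪gradient f (x + t • v x), v x⟫‖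
      ≤ ‖gradient f (x + t • v x)‖ * ‖v x‖ := norm_inner_le_norm _ _
    _ ≤ ‖gradient f (x + t • v x)‖ := mul_le_of_le_one_right (norm_nonneg _) (hv x hx)
    _ ≤ C := h

theorem hasDerivAt_setIntegral_add_smul [MeasurableSpace E] [BorelSpace E]
    [SecondCountableTopology E] {μ : Measure E} [IsFiniteMeasure μ] {A : ℝ}
    (hf : ContDiff ℝ 1 f) (hK : MeasurableSet K) (hvm : Measurable v)
    (hv : ∀ x ∈ K, ‖v x‖ ≤ 1) (hA : ∀ y ∈ Metric.cthickening 1 K, ‖f y‖ ≤ A)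
    (hC : ∀ y ∈ Metric.cthickening 1 K, ‖gradient f y‖ ≤ C) (ht : |t| < 1) :
    HasDerivAt (fun s : ℝ => ∫ x in K, f (x + s • v x) ∂μ)
      (∫ x in K, ⟪gradient f (x + t • v x), v x⟫ ∂μ) t := by
  have hmeas (s : ℝ) : Measurable fun x => x + s • v x := measurable_id.add (hvm.const_smul s)
  have hfm (s : ℝ) : AEStronglyMeasurable (fun x => f (x + s • v x)) (μ.restrict K) :=
    (hf.continuous.measurable.comp (hmeas s)).aestronglyMeasurable
  refine (hasDerivAt_integral_of_dominated_loc_of_deriv_le (μ := μ.restrict K)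
    (s := Set.Ioo (-1) 1) (bound := fun _ => C)
    (F' := fun s x => ⟪gradient f (x + s • v x), v x⟫)
    (Ioo_mem_nhds (abs_lt.1 ht).1 (abs_lt.1 ht).2) (.of_forall hfm) ?_ ?_ ?_
    (integrable_const C) ?_).2
  · refine Integrable.of_bound (hfm t) A ?_
    filter_upwards [ae_restrict_mem hK] with x hx
    exact hA _ (add_smul_mem_cthickening_one hx (hv x hx) ht.le)
  · exact ((hf.continuous_gradient.measurable.comp (hmeas t)).inner hvm).aestronglyMeasurable
  · filter_upwards [ae_restrict_mem hK] with x hx s hs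
    exact norm_inner_gradient_add_smul_le hC hv (abs_lt.2 hs).le hx
  · refine .of_forall fun x s _ => ?_
    have hd : HasDerivAt (fun s : ℝ => x + s • v x) (v x) s := by
      simpa using ((hasDerivAt_id s).smul_const (v x)).const_add x
    rw [inner_gradient_left]
    exact ((hf.differentiable one_ne_zero) _).hasFDerivAt.comp_hasDerivAt s hd

end DisplacedIntegral

/-- intrinsic differentiability of the distance-like functional
`S(μ) = Σ_n c_n ⟨μ, f_n⟩²`: the map
`ε ↦ Σ_n c_n (∫ f_n(x + ε v(x)) dμ)²` is differentiable at `ε = 0` with derivative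
`Σ_n 2 c_n ⟨μ, f_n⟩ ∫ ⟨∇f_n, v⟩ dμ`. -/
theorem distance_like_functional_hasDerivAt {d : ℕ} (hd : 1 ≤ d)
    (K : Set (EuclideanSpace ℝ (Fin d))) (hK : IsCompact K)
    (f : {n : Fin d → ℕ // 1 ≤ ∑ i, n i} → EuclideanSpace ℝ (Fin d) → ℝ)
    (c : {n : Fin d → ℕ // 1 ≤ ∑ i, n i} → ℝ)
    (hf : ∀ n, ContDiff ℝ 1 (f n)) (hc : ∀ n, 0 ≤ c n)
    (hsum : Summable (fun n => c n * sSup ((fun x => (f n x) ^ 2 + ‖gradient (f n) x‖ ^ 2)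
      '' Metric.cthickening 1 K)))
    (μ : Measure (EuclideanSpace ℝ (Fin d))) [IsProbabilityMeasure μ] (hμK : μ Kᶜ = 0)
    (v : EuclideanSpace ℝ (Fin d) → EuclideanSpace ℝ (Fin d))
    (hvmeas : Measurable v) (hvbd : ∀ x ∈ K, ‖v x‖ ≤ 1) :
    HasDerivAt (fun ε : ℝ => ∑' n, c n * (∫ x in K, f n (x + ε • v x) ∂μ) ^ 2)
      (∑' n, 2 * c n * (∫ x in K, f n x ∂μ) * ∫ x in K, ⟪gradient (f n) x, v x⟫ ∂μ)
      0 := by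
  set M : {n : Fin d → ℕ // 1 ≤ ∑ i, n i} → ℝ := fun n =>
    sSup ((fun x => (f n x) ^ 2 + ‖gradient (f n) x‖ ^ 2) '' Metric.cthickening 1 K)
  have hle (n) (y) (hy : y ∈ Metric.cthickening 1 K) :
      (f n y) ^ 2 + ‖gradient (f n) y‖ ^ 2 ≤ M n := by
    refine le_csSup (hK.cthickening.image ?_).bddAbove (Set.mem_image_of_mem _ hy)
    exact ((hf n).continuous.pow 2).add ((hf n).continuous_gradient.norm.pow 2)
  have hA (n) (y) (hy : y ∈ Metric.cthickening 1 K) : ‖f n y‖ ≤ √(M n) :=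
    Real.abs_le_sqrt (by linarith [hle n y hy, sq_nonneg ‖gradient (f n) y‖])
  have hC (n) (y) (hy : y ∈ Metric.cthickening 1 K) : ‖gradient (f n) y‖ ≤ √(M n) :=
    Real.le_sqrt_of_sq_le (by linarith [hle n y hy, sq_nonneg (f n y)])
  have hKne : K.Nonempty := by
    rw [Set.nonempty_iff_ne_empty]
    rintro rfl
    simp at hμK
  have hM (n) : 0 ≤ M n := by
    obtain ⟨x, hx⟩ := hKne
    have := hle n x (Metric.self_subset_cthickening K hx)
    exact le_trans (by positivity) this
  have hint (n) {g : EuclideanSpace ℝ (Fin d) → ℝ} (hg : ∀ x ∈ K, ‖g x‖ ≤ √(M n)) :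
      ‖∫ x in K, g x ∂μ‖ ≤ √(M n) :=
    (norm_setIntegral_le_of_norm_le_const (measure_lt_top μ K) hg).trans
      (mul_le_of_le_one_right (Real.sqrt_nonneg _) measureReal_le_one)
  have hI (n) (t : ℝ) (ht : |t| ≤ 1) : ‖∫ x in K, f n (x + t • v x) ∂μ‖ ≤ √(M n) :=
    hint n fun x hx => hA n _ (add_smul_mem_cthickening_one hx (hvbd x hx) ht)
  have h0 : (0 : ℝ) ∈ Set.Ioo (-1 : ℝ) 1 := by norm_num
  have key := hasDerivAt_tsum_of_isPreconnected (𝕜 := ℝ) (t := Set.Ioo (-1 : ℝ) 1) (y₀ := 0)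
    (g := fun n ε => c n * (∫ x in K, f n (x + ε • v x) ∂μ) ^ 2)
    (g' := fun n ε => 2 * c n * (∫ x in K, f n (x + ε • v x) ∂μ) *
      ∫ x in K, ⟪gradient (f n) (x + ε • v x), v x⟫ ∂μ)
    (hsum.mul_left 2) isOpen_Ioo isPreconnected_Ioo ?_ ?_ h0 ?_ h0
  · simpa using key
  · intro n t ht
    have hd := hasDerivAt_setIntegral_add_smul (μ := μ) (hf n) hK.measurableSet hvmeas hvbd
      (hA n) (hC n) (abs_lt.2 ht)
    refine ((hd.fun_pow 2).const_mul (c n)).congr_deriv ?_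
    simp only [Nat.cast_ofNat, Nat.add_one_sub_one, pow_one]
    ring
  · intro n t ht
    have ht' : |t| ≤ 1 := (abs_lt.2 ht).le
    rw [norm_mul, norm_mul, Real.norm_of_nonneg (mul_nonneg zero_le_two (hc n)), mul_assoc]
    calc _ ≤ 2 * c n * (√(M n) * √(M n)) := by
          have := hc n
          gcongr
          · exact hI n t ht'
          · exact hint n fun x hx => norm_inner_gradient_add_smul_le (hC n) hvbd ht' hx
      _ = 2 * (c n * M n) := by rw [Real.mul_self_sqrt (hM n), mul_assoc]
  · refine hsum.of_nonneg_of_le (fun n => mul_nonneg (hc n) (sq_nonneg _)) fun n => ?_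
    refine mul_le_mul_of_nonneg_left ?_ (hc n)
    change _ ≤ M n
    rw [← Real.sq_sqrt (hM n), ← sq_abs]
    exact pow_le_pow_left₀ (abs_nonneg _) (hI n 0 (by simp)) 2
end

section
/- Let d ≥ 1, K ⊆ ℝ^d compact, μ_k, μ probability measures on K, and T_k, T : K → K Borel maps with T continuous. If the pushforward measures (Id, T_k)_# μ_k on K × K (pushforward of μ_k under x ↦ (x, T_k(x))) converge weakly to (Id, T)_# μ as k → ∞, then for every ε > 0, μ_k({x ∈ K : |T_k(x) − T(x)| ≥ ε}) → 0 as k → ∞. -/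
open MeasureTheory

open Filter

/-- stability of transport maps: if the plans `(Id, T_k)_# μ_k`
converge weakly to `(Id, T)_# μ` with `T` continuous, then `T_k → T` in
`μ_k`-measure. -/
theorem tendsto_measure_of_weak_convergence_graphs {d : ℕ} (hd : 1 ≤ d)
    (K : Set (EuclideanSpace ℝ (Fin d))) (hK : IsCompact K)
    (μ : ℕ → Measure (EuclideanSpace ℝ (Fin d))) (ν : Measure (EuclideanSpace ℝ (Fin d)))
    [∀ k, IsProbabilityMeasure (μ k)] [IsProbabilityMeasure ν]
    (hμK : ∀ k, μ k Kᶜ = 0) (hνK : ν Kᶜ = 0)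
    (T : ℕ → EuclideanSpace ℝ (Fin d) → EuclideanSpace ℝ (Fin d))
    (T' : EuclideanSpace ℝ (Fin d) → EuclideanSpace ℝ (Fin d))
    (hTmeas : ∀ k, Measurable (T k)) (hT'meas : Measurable T')
    (hTK : ∀ k, Set.MapsTo (T k) K K) (hT'K : Set.MapsTo T' K K)
    (hT'cont : ContinuousOn T' K)
    (hweak : ∀ g : EuclideanSpace ℝ (Fin d) × EuclideanSpace ℝ (Fin d) → ℝ,
      Continuous g →
      Tendsto (fun k => ∫ z, g z ∂((μ k).map (fun x => (x, T k x)))) atTop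
        (nhds (∫ z, g z ∂(ν.map (fun x => (x, T' x)))))) :
    ∀ ε > (0 : ℝ),
      Tendsto (fun k => μ k {x ∈ K | ε ≤ ‖T k x - T' x‖}) atTop (nhds 0) := by
  intro ε hε
  have hgraph : ∀ k, Measurable fun x => (x, T k x) := fun k => measurable_id.prodMk (hTmeas k)
  have hgraph' : Measurable fun x => (x, T' x) := measurable_id.prodMk hT'meas
  let γ : ℕ → ProbabilityMeasure (EuclideanSpace ℝ (Fin d) × EuclideanSpace ℝ (Fin d)) :=
    fun k => ⟨(μ k).map fun x => (x, T k x),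
      Measure.isProbabilityMeasure_map (hgraph k).aemeasurable⟩
  let γ' : ProbabilityMeasure (EuclideanSpace ℝ (Fin d) × EuclideanSpace ℝ (Fin d)) :=
    ⟨ν.map fun x => (x, T' x), Measure.isProbabilityMeasure_map hgraph'.aemeasurable⟩
  have hγ : Tendsto γ atTop (nhds γ') :=
    ProbabilityMeasure.tendsto_iff_forall_integral_tendsto.2 fun g => hweak g g.continuous
  let B : Set (EuclideanSpace ℝ (Fin d) × EuclideanSpace ℝ (Fin d)) :=
    Prod.fst ⁻¹' K ∩ (fun z => ‖z.2 - T' z.1‖) ⁻¹' Set.Ici ε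
  have hB : IsClosed B := by
    refine ContinuousOn.preimage_isClosed_of_isClosed ?_
      (hK.isClosed.preimage continuous_fst) isClosed_Ici
    exact (continuousOn_snd.sub
      (hT'cont.comp continuousOn_fst fun _ hz => hz)).norm
  have hγB : ∀ k, (γ k : Measure _) B = μ k {x ∈ K | ε ≤ ‖T k x - T' x‖} := fun k =>
    Measure.map_apply (hgraph k) hB.measurableSet
  have hγ'B : (γ' : Measure _) B = 0 := by
    refine (Measure.map_apply hgraph' hB.measurableSet).trans ?_
    convert measure_empty (μ := ν)
    ext x
    simp [B, hε]
  have hlim := ProbabilityMeasure.limsup_measure_closed_le_of_tendsto hγ hB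
  simp only [hγB, hγ'B] at hlim
  exact tendsto_of_le_liminf_of_limsup_le zero_le hlim
end

section
/- Let d ≥ 1, K ⊆ ℝ^d compact, μ_k, μ probability measures on K, and T_k, T : K → K Borel maps with T continuous. If the pushforward measures (Id, T_k)_# μ_k on K × K converge weakly to (Id, T)_# μ as k → ∞, then ∫_K |T_k(x) − T(x)| dμ_k(x) → 0 as k → ∞. -/
open MeasureTheory

open Filter

/-- L¹-stability of transport maps: if the plans `(Id, T_k)_# μ_k`
converge weakly to `(Id, T)_# μ` with `T` continuous, then
`∫_K |T_k − T| dμ_k → 0`. -/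
theorem tendsto_integral_dist_of_weak_convergence_graphs {d : ℕ} (hd : 1 ≤ d)
    (K : Set (EuclideanSpace ℝ (Fin d))) (hK : IsCompact K)
    (μ : ℕ → Measure (EuclideanSpace ℝ (Fin d))) (ν : Measure (EuclideanSpace ℝ (Fin d)))
    [∀ k, IsProbabilityMeasure (μ k)] [IsProbabilityMeasure ν]
    (hμK : ∀ k, μ k Kᶜ = 0) (hνK : ν Kᶜ = 0)
    (T : ℕ → EuclideanSpace ℝ (Fin d) → EuclideanSpace ℝ (Fin d))
    (T' : EuclideanSpace ℝ (Fin d) → EuclideanSpace ℝ (Fin d))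
    (hTmeas : ∀ k, Measurable (T k)) (hT'meas : Measurable T')
    (hTK : ∀ k, Set.MapsTo (T k) K K) (hT'K : Set.MapsTo T' K K)
    (hT'cont : ContinuousOn T' K)
    (hweak : ∀ g : EuclideanSpace ℝ (Fin d) × EuclideanSpace ℝ (Fin d) → ℝ,
      Continuous g →
      Tendsto (fun k => ∫ z, g z ∂((μ k).map (fun x => (x, T k x)))) atTop
        (nhds (∫ z, g z ∂(ν.map (fun x => (x, T' x)))))) :
    Tendsto (fun k => ∫ x in K, ‖T k x - T' x‖ ∂(μ k)) atTop (nhds 0) := by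
  have : TietzeExtension.{0} (EuclideanSpace ℝ (Fin d)) :=
    TietzeExtension.of_tvs ℝ
  obtain ⟨S, hS⟩ := ContinuousMap.exists_restrict_eq hK.isClosed
    ⟨K.domRestrict T', hT'cont.domRestrict⟩
  have hST : ∀ x ∈ K, S x = T' x := fun x hx => DFunLike.congr_fun hS ⟨x, hx⟩
  have hg : Continuous fun z : EuclideanSpace ℝ (Fin d) × EuclideanSpace ℝ (Fin d) =>
      ‖z.2 - S z.1‖ := by fun_prop
  have hlim := hweak _ hg
  have hν0 : ∫ z, ‖z.2 - S z.1‖ ∂(ν.map fun x => (x, T' x)) = 0 := by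
    rw [integral_map (by fun_prop) hg.aestronglyMeasurable]
    refine integral_eq_zero_of_ae ?_
    filter_upwards [mem_ae_iff.2 hνK] with x hx
    simp [hST x hx]
  rw [hν0] at hlim
  refine hlim.congr fun k => ?_
  have hk := hTmeas k
  rw [integral_map (by fun_prop) hg.aestronglyMeasurable,
    ← Measure.restrict_eq_self_of_ae_mem (mem_ae_iff.2 (hμK k)),
    Measure.restrict_restrict_of_subset subset_rfl]
  exact setIntegral_congr_fun hK.measurableSet fun x hx => by simp [hST x hx]
end

section
/- Let d ≥ 1 and K ⊆ ℝ^d compact. For each multi-index n with |n| ≥ 1 let f_n : ℝ^d → ℝ be continuously differentiable on a neighborhood of K and c_n ≥ 0. Suppose that for each n and each i ∈ {1, …, d} there is a multi-index l_i(n) with ∂_{x_i} f_n = f_{l_i(n)} on K and c_n ≤ c_{l_i(n)}, and that for each fixed i the map n ↦ l_i(n) is injective. Then for any probability measures μ, ν on K, Σ_n c_n |∫_K ∇f_n dμ − ∫_K ∇f_n dν|² ≤ d · Σ_n c_n (∫_K f_n dμ − ∫_K f_n dν)² (an inequality in [0, ∞]). -/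
open MeasureTheory

open scoped ENNReal

/-- On a compact subset of an open set where `f` is `C¹`, the coordinates of the integrated gradient
are the integrated partial derivatives. -/
theorem setIntegral_gradient_apply {d : ℕ} {K V : Set (EuclideanSpace ℝ (Fin d))}
    {f : EuclideanSpace ℝ (Fin d) → ℝ} (hK : IsCompact K) (hV : IsOpen V) (hKV : K ⊆ V)
    (hf : ContDiffOn ℝ 1 f V) (μ : Measure (EuclideanSpace ℝ (Fin d))) [IsFiniteMeasure μ]
    (i : Fin d) :
    (∫ x in K, gradient f x ∂μ) i =
      ∫ x in K, fderiv ℝ f x (EuclideanSpace.single i 1) ∂μ := by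
  have hcont : ContinuousOn (gradient f) K :=
    (InnerProductSpace.toDual ℝ (EuclideanSpace ℝ (Fin d))).symm.continuous.comp_continuousOn
      ((hf.continuousOn_fderiv_of_isOpen hV le_rfl).mono hKV)
  have h := (EuclideanSpace.proj i : EuclideanSpace ℝ (Fin d) →L[ℝ] ℝ).integral_comp_comm
    (hcont.integrableOn_compact (μ := μ) hK)
  refine h.symm.trans (integral_congr_ae (ae_of_all _ fun x => ?_))
  have hx : inner ℝ (gradient f x) (EuclideanSpace.single i 1) =
      fderiv ℝ f x (EuclideanSpace.single i 1) :=
    InnerProductSpace.toDual_symm_apply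
  rw [EuclideanSpace.inner_single_right, RCLike.conj_to_real] at hx
  exact (one_mul _).symm.trans hx

/-- the key estimate (h-12) of the comparison principle: if the family
`{f_n}` is closed under partial differentiation, `∂_i f_n = f_{l_i(n)}` with
`c_n ≤ c_{l_i(n)}` and `n ↦ l_i(n)` injective, then
`Σ_n c_n |⟨μ − ν, ∇f_n⟩|² ≤ d · Σ_n c_n ⟨μ − ν, f_n⟩²` (in `[0, ∞]`). -/
theorem gradient_sum_le_dim_mul_sum {d : ℕ} (hd : 1 ≤ d)
    (K : Set (EuclideanSpace ℝ (Fin d))) (hK : IsCompact K)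
    (f : {n : Fin d → ℕ // 1 ≤ ∑ i, n i} → EuclideanSpace ℝ (Fin d) → ℝ)
    (c : {n : Fin d → ℕ // 1 ≤ ∑ i, n i} → ℝ) (hc : ∀ n, 0 ≤ c n)
    (hf : ∀ n, ∃ V : Set (EuclideanSpace ℝ (Fin d)),
      IsOpen V ∧ K ⊆ V ∧ ContDiffOn ℝ 1 (f n) V)
    (l : {n : Fin d → ℕ // 1 ≤ ∑ i, n i} → Fin d → {n : Fin d → ℕ // 1 ≤ ∑ i, n i})
    (hder : ∀ n, ∀ i : Fin d, ∀ x ∈ K,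
      fderiv ℝ (f n) x (EuclideanSpace.single i 1) = f (l n i) x)
    (hmono : ∀ n, ∀ i : Fin d, c n ≤ c (l n i))
    (hinj : ∀ i : Fin d, Function.Injective (fun n => l n i))
    (μ ν : Measure (EuclideanSpace ℝ (Fin d)))
    [IsProbabilityMeasure μ] [IsProbabilityMeasure ν]
    (hμK : μ Kᶜ = 0) (hνK : ν Kᶜ = 0) :
    ∑' n, ENNReal.ofReal
        (c n * ‖(∫ x in K, gradient (f n) x ∂μ) - ∫ x in K, gradient (f n) x ∂ν‖ ^ 2) ≤
      (d : ℝ≥0∞) * ∑' n, ENNReal.ofReal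
        (c n * ((∫ x in K, f n x ∂μ) - ∫ x in K, f n x ∂ν) ^ 2) := by
  have hcoord : ∀ n i (ρ : Measure (EuclideanSpace ℝ (Fin d))) [IsProbabilityMeasure ρ],
      (∫ x in K, gradient (f n) x ∂ρ) i = ∫ x in K, f (l n i) x ∂ρ := by
    intro n i ρ _
    obtain ⟨V, hV, hKV, hfV⟩ := hf n
    rw [setIntegral_gradient_apply hK hV hKV hfV ρ i]
    exact setIntegral_congr_fun hK.measurableSet fun x hx => hder n i x hx
  set g : {n : Fin d → ℕ // 1 ≤ ∑ i, n i} → ℝ :=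
    fun n => (∫ x in K, f n x ∂μ) - ∫ x in K, f n x ∂ν with hg
  calc ∑' n, ENNReal.ofReal
        (c n * ‖(∫ x in K, gradient (f n) x ∂μ) - ∫ x in K, gradient (f n) x ∂ν‖ ^ 2)
      = ∑' n, ∑ i, ENNReal.ofReal (c n * g (l n i) ^ 2) := by
        refine tsum_congr fun n => ?_
        rw [EuclideanSpace.real_norm_sq_eq, Finset.mul_sum,
          ENNReal.ofReal_sum_of_nonneg fun i _ => mul_nonneg (hc n) (sq_nonneg _)]
        simp only [PiLp.sub_apply, hcoord, hg]
    _ ≤ ∑' n, ∑ i, ENNReal.ofReal (c (l n i) * g (l n i) ^ 2) := by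
        gcongr with n i
        exact hmono n i
    _ = ∑ i, ∑' n, ENNReal.ofReal (c (l n i) * g (l n i) ^ 2) :=
        Summable.tsum_finsetSum fun _ _ => ENNReal.summable
    _ ≤ ∑ _i : Fin d, ∑' n, ENNReal.ofReal (c n * g n ^ 2) :=
        Finset.sum_le_sum fun i _ => ENNReal.tsum_comp_le_tsum_of_injective (hinj i)
          fun n => ENNReal.ofReal (c n * g n ^ 2)
    _ = (d : ℝ≥0∞) * ∑' n, ENNReal.ofReal (c n * g n ^ 2) := by simp
end

section
/- Let d ≥ 1, K ⊆ ℝ^d compact, κ₁, κ₂ > 0, 0 ≤ t₀ < T, μ₀ a probability measure on K, and p : K × (t₀, T] × K → [0, ∞) Borel such that: (i) ∫_K p(y, r, x) dx = 1 for all y ∈ K, r ∈ (t₀, T]; (ii) p(y, r, x) ≤ κ₁ (r − t₀)^{−d/2} exp(−κ₂|x − y|²/(r − t₀)) for all x, y ∈ K, r ∈ (t₀, T]; (iii) for all x, y the map r ↦ p(y, r, x) is differentiable on (t₀, T] with |∂_r p(y, r, x)| ≤ κ₁ (r − t₀)^{−(d+2)/2} exp(−κ₂|x − y|²/(r − t₀)).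 For r ∈ (t₀, T] let μ_r be the probability measure on K with Lebesgue density x ↦ ∫_K p(y, r, x) dμ₀(y), and set μ_{t₀} := μ₀. Then for every s ∈ [t₀, T), lim_{t → s, t ∈ (s, T]} W₁(μ_t, μ_s) = 0. -/
open MeasureTheory

open Filter

open Topology ENNReal

section Wasserstein

variable {d : ℕ} {μ ν A B C lam : Measure (EuclideanSpace ℝ (Fin d))}
  {Γ : Measure (EuclideanSpace ℝ (Fin d) × EuclideanSpace ℝ (Fin d))}

lemma wasserstein_one_nonneg : 0 ≤ wasserstein 1 μ ν := by
  apply Real.sInf_nonneg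
  rintro c ⟨Γ, -, rfl⟩
  positivity

lemma IsCoupling.wasserstein_one_le (h : IsCoupling μ ν Γ) :
    wasserstein 1 μ ν ≤ (∫⁻ z, ‖z.1 - z.2‖ₑ ∂Γ).toReal := by
  apply csInf_le
  · refine ⟨0, ?_⟩
    rintro c ⟨Γ, -, rfl⟩
    positivity
  · refine ⟨Γ, h, ?_⟩
    simp only [Real.rpow_one, div_one]
    exact (integral_norm_eq_lintegral_enorm (by fun_prop)).symm

/-- Squeeze criterion for convergence in `W₁`: it suffices to have couplings of vanishing cost. -/
lemma tendsto_wasserstein_one_zero {ι : Type*} {l : Filter ι}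
    {μ ν : ι → Measure (EuclideanSpace ℝ (Fin d))} {c : ι → ℝ≥0∞} (hc : Tendsto c l (𝓝 0))
    (h : ∀ᶠ i in l, ∃ Γ, IsCoupling (μ i) (ν i) Γ ∧ ∫⁻ z, ‖z.1 - z.2‖ₑ ∂Γ ≤ c i) :
    Tendsto (fun i => wasserstein 1 (μ i) (ν i)) l (𝓝 0) := by
  refine tendsto_of_tendsto_of_tendsto_of_le_of_le' tendsto_const_nhds
    ((ENNReal.tendsto_toReal zero_ne_top).comp hc) (.of_forall fun i => wasserstein_one_nonneg) ?_
  filter_upwards [h, hc.eventually_lt_const ENNReal.zero_lt_top] with i ⟨Γ, hΓ, hle⟩ hlt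
  exact hΓ.wasserstein_one_le.trans (ENNReal.toReal_mono hlt.ne hle)

/-- Two probability measures with a common part `C` and remainders `A`, `B` admit a coupling that
keeps `C` on the diagonal and takes the normalized product of the remainders. -/
lemma exists_isCoupling_of_common_part [IsProbabilityMeasure μ] [IsFiniteMeasure A]
    [IsFiniteMeasure B] [IsFiniteMeasure C]
    (hμ : C + A = μ) (hν : C + B = ν) (hAB : A Set.univ = B Set.univ)
    {D : ℝ≥0∞} (hD : ∀ᵐ z ∂A.prod B, ‖z.1 - z.2‖ₑ ≤ D) :
    ∃ Γ, IsCoupling μ ν Γ ∧ ∫⁻ z, ‖z.1 - z.2‖ₑ ∂Γ ≤ D * B Set.univ := by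
  have hm : Measurable fun x : EuclideanSpace ℝ (Fin d) => (x, x) := by fun_prop
  have key : ∀ M : Measure (EuclideanSpace ℝ (Fin d)), M Set.univ = B Set.univ →
      ((B Set.univ)⁻¹ * B Set.univ) • M = M := by
    intro M hM
    by_cases h0 : B Set.univ = 0
    · rw [h0, Measure.measure_univ_eq_zero] at hM
      simp [hM]
    · rw [ENNReal.inv_mul_cancel h0 (measure_ne_top _ _), one_smul]
  let Γ := C.map (fun x => (x, x)) + (B Set.univ)⁻¹ • A.prod B
  have h1 : Γ.map Prod.fst = μ := by
    simp only [Γ]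
    rw [Measure.map_add _ _ measurable_fst, Measure.map_map measurable_fst hm, Measure.map_smul,
      Measure.map_fst_prod, smul_smul, key A hAB, ← hμ]
    congr 1
    exact Measure.map_id
  have h2 : Γ.map Prod.snd = ν := by
    simp only [Γ]
    rw [Measure.map_add _ _ measurable_snd, Measure.map_map measurable_snd hm, Measure.map_smul,
      Measure.map_snd_prod, hAB, smul_smul, key B rfl, ← hν]
    congr 1
    exact Measure.map_id
  refine ⟨Γ, ⟨⟨?_⟩, h1, h2⟩, ?_⟩
  · have := congrArg (fun M => M Set.univ) h1
    simpa [Measure.map_apply measurable_fst MeasurableSet.univ] using this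
  · simp only [Γ]
    rw [lintegral_add_measure, lintegral_map (by fun_prop) hm, lintegral_smul_measure]
    simp only [sub_self, enorm_zero, lintegral_zero, zero_add, smul_eq_mul]
    calc (B Set.univ)⁻¹ * ∫⁻ z, ‖z.1 - z.2‖ₑ ∂A.prod B
        ≤ (B Set.univ)⁻¹ * (D * (B Set.univ * B Set.univ)) := by
          gcongr
          refine (lintegral_mono_ae hD).trans ?_
          rw [lintegral_const, ← Set.univ_prod_univ, Measure.prod_prod, hAB]
      _ = D * (((B Set.univ)⁻¹ * B Set.univ) * B Set.univ) := by ring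
      _ ≤ D * (1 * B Set.univ) := by
          gcongr
          exact ENNReal.inv_mul_le_one _
      _ = D * B Set.univ := by rw [one_mul]

/-- Two probability densities supported in a set of diameter at most `D` admit a coupling whose
cost is at most `D` times their total variation distance. -/
lemma exists_isCoupling_withDensity {f g : EuclideanSpace ℝ (Fin d) → ℝ≥0∞}
    [SFinite lam] (hf : Measurable f) (hg : Measurable g)
    (hf1 : ∫⁻ x, f x ∂lam = 1) (hg1 : ∫⁻ x, g x ∂lam = 1)
    {D : ℝ≥0∞} (hD : ∀ᵐ z ∂lam.prod lam, ‖z.1 - z.2‖ₑ ≤ D) :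
    ∃ Γ, IsCoupling (lam.withDensity f) (lam.withDensity g) Γ ∧
      ∫⁻ z, ‖z.1 - z.2‖ₑ ∂Γ ≤ D * ∫⁻ x, (g x - f x) ∂lam := by
  have hfin : ∀ h : EuclideanSpace ℝ (Fin d) → ℝ≥0∞, ∫⁻ x, h x ∂lam ≤ 1 →
      IsFiniteMeasure (lam.withDensity h) := fun h hh =>
    isFiniteMeasure_withDensity (hh.trans_lt ENNReal.one_lt_top).ne
  have : IsProbabilityMeasure (lam.withDensity f) := ⟨by simpa using hf1⟩
  have iA : IsFiniteMeasure (lam.withDensity (fun x => f x - g x)) :=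
    hfin _ ((lintegral_mono fun x => tsub_le_self).trans hf1.le)
  have iB : IsFiniteMeasure (lam.withDensity (fun x => g x - f x)) :=
    hfin _ ((lintegral_mono fun x => tsub_le_self).trans hg1.le)
  have iC : IsFiniteMeasure (lam.withDensity (fun x => min (f x) (g x))) :=
    hfin _ ((lintegral_mono fun x => min_le_left _ _).trans hf1.le)
  have hμ : lam.withDensity (fun x => min (f x) (g x)) + lam.withDensity (fun x => f x - g x)
      = lam.withDensity f := by
    rw [← withDensity_add_left (hf.min hg)]
    congr 1
    ext x
    simp [add_comm (min _ _), tsub_add_min]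
  have hν : lam.withDensity (fun x => min (f x) (g x)) + lam.withDensity (fun x => g x - f x)
      = lam.withDensity g := by
    rw [← withDensity_add_left (hf.min hg)]
    congr 1
    ext x
    simp [add_comm (min _ _), min_comm (f x), tsub_add_min]
  have hAB : lam.withDensity (fun x => f x - g x) Set.univ
      = lam.withDensity (fun x => g x - f x) Set.univ := by
    have e1 := congrArg (fun M => M Set.univ) hμ
    have e2 := congrArg (fun M => M Set.univ) hν
    simp only [Measure.add_apply] at e1 e2
    have e3 : lam.withDensity f Set.univ = lam.withDensity g Set.univ := by
      rw [withDensity_apply _ .univ, withDensity_apply _ .univ, setLIntegral_univ, setLIntegral_univ,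
        hf1, hg1]
    exact (ENNReal.add_right_inj (measure_ne_top _ _)).1 (e1.trans (e3.trans e2.symm))
  have hac : (lam.withDensity (fun x => f x - g x)).prod (lam.withDensity (fun x => g x - f x))
      ≪ lam.prod lam :=
    (withDensity_absolutelyContinuous _ _).prod (withDensity_absolutelyContinuous _ _)
  obtain ⟨Γ, h, hle⟩ := exists_isCoupling_of_common_part hμ hν hAB (hac.ae_le hD)
  exact ⟨Γ, h, by simpa using hle⟩

/-- The coupling of `ν` with its image under the Markov kernel with density `q`. -/
lemma isCoupling_withDensity_kernel {q : EuclideanSpace ℝ (Fin d) → EuclideanSpace ℝ (Fin d) → ℝ≥0∞}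
    [SFinite lam] [IsProbabilityMeasure ν] (hq : Measurable (Function.uncurry q))
    (hq1 : ∀ᵐ y ∂ν, ∫⁻ x, q y x ∂lam = 1) :
    IsCoupling (lam.withDensity fun x => ∫⁻ y, q y x ∂ν) ν
      ((lam.prod ν).withDensity fun z => q z.2 z.1) := by
  have hq' : Measurable fun z : EuclideanSpace ℝ (Fin d) × EuclideanSpace ℝ (Fin d) =>
      q z.2 z.1 := hq.comp measurable_swap
  have h2 : ((lam.prod ν).withDensity fun z => q z.2 z.1).map Prod.snd = ν := by
    ext s hs
    rw [Measure.map_apply measurable_snd hs, withDensity_apply _ (measurable_snd hs),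
      ← Set.univ_prod, ← Measure.prod_restrict, Measure.restrict_univ,
      lintegral_prod_symm _ hq'.aemeasurable,
      lintegral_congr_ae (ae_restrict_of_ae hq1)]
    simp
  refine ⟨⟨?_⟩, ?_, h2⟩
  · have := congrArg (fun M => M Set.univ) h2
    simpa [Measure.map_apply measurable_snd MeasurableSet.univ] using this
  · ext s hs
    rw [Measure.map_apply measurable_fst hs, withDensity_apply _ (measurable_fst hs),
      ← Set.prod_univ, ← Measure.prod_restrict, Measure.restrict_univ,
      lintegral_prod _ hq'.aemeasurable, withDensity_apply _ hs]

end Wasserstein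

lemma tendsto_rpow_mul_exp_neg_div_nhdsGT_zero (a : ℝ) {b : ℝ} (hb : 0 < b) :
    Tendsto (fun u : ℝ => u ^ (-a) * Real.exp (-b / u)) (𝓝[>] 0) (𝓝 0) := by
  refine ((tendsto_rpow_mul_exp_neg_mul_atTop_nhds_zero a b hb).comp
    tendsto_inv_nhdsGT_zero).congr' ?_
  filter_upwards [self_mem_nhdsWithin] with u hu
  simp only [Function.comp]
  rw [Real.inv_rpow (le_of_lt hu), Real.rpow_neg (le_of_lt hu), div_eq_mul_inv]

/-- Lemma 3.9: right-continuity in `W₁` of the law curve `t ↦ μ_t` of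
the controlled reflected diffusion, whose density is given by a transition kernel
satisfying the Gaussian heat-kernel estimates. -/
theorem tendsto_wassersteinOne_right_continuity {d : ℕ} (hd : 1 ≤ d)
    (K : Set (EuclideanSpace ℝ (Fin d))) (hK : IsCompact K)
    (κ₁ κ₂ : ℝ) (hκ₁ : 0 < κ₁) (hκ₂ : 0 < κ₂)
    (t₀ T : ℝ) (ht₀ : 0 ≤ t₀) (ht₀T : t₀ < T)
    (μ₀ : Measure (EuclideanSpace ℝ (Fin d))) [IsProbabilityMeasure μ₀] (hμ₀K : μ₀ Kᶜ = 0)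
    (p p' : EuclideanSpace ℝ (Fin d) → ℝ → EuclideanSpace ℝ (Fin d) → ℝ)
    (hpmeas : Measurable (fun q : EuclideanSpace ℝ (Fin d) × ℝ × EuclideanSpace ℝ (Fin d) =>
      p q.1 q.2.1 q.2.2))
    (hpnn : ∀ y r x, 0 ≤ p y r x)
    (hpint : ∀ y ∈ K, ∀ r ∈ Set.Ioc t₀ T, ∫ x in K, p y r x = 1)
    (hpbd : ∀ y ∈ K, ∀ x ∈ K, ∀ r ∈ Set.Ioc t₀ T,
      p y r x ≤ κ₁ * (r - t₀) ^ (-(d : ℝ) / 2) * Real.exp (-κ₂ * ‖x - y‖ ^ 2 / (r - t₀)))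
    (hpderiv : ∀ y x, ∀ r ∈ Set.Ioc t₀ T,
      HasDerivWithinAt (fun u => p y u x) (p' y r x) (Set.Ioc t₀ T) r)
    (hp'bd : ∀ y ∈ K, ∀ x ∈ K, ∀ r ∈ Set.Ioc t₀ T,
      |p' y r x| ≤ κ₁ * (r - t₀) ^ (-((d : ℝ) + 2) / 2) *
        Real.exp (-κ₂ * ‖x - y‖ ^ 2 / (r - t₀)))
    (μ : ℝ → Measure (EuclideanSpace ℝ (Fin d)))
    (hμt₀ : μ t₀ = μ₀)
    (hμ : ∀ r ∈ Set.Ioc t₀ T, μ r = (volume.restrict K).withDensity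
      (fun x => ENNReal.ofReal (∫ y in K, p y r x ∂μ₀))) :
    ∀ s ∈ Set.Ico t₀ T,
      Tendsto (fun t => wasserstein 1 (μ t) (μ s)) (nhdsWithin s (Set.Ioc s T))
        (nhds 0) := by
  have hKm := hK.measurableSet
  have hvol : volume K ≠ ⊤ := hK.measure_lt_top.ne
  have : IsFiniteMeasure (volume.restrict K) := ⟨by simpa using hK.measure_lt_top⟩
  have hμ₀ae : ∀ᵐ y ∂μ₀, y ∈ K := by rwa [ae_iff]
  have hres : μ₀.restrict K = μ₀ := Measure.restrict_eq_self_of_ae_mem hμ₀ae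
  obtain ⟨D, hD0, hD⟩ : ∃ D : ℝ, 0 ≤ D ∧ ∀ x ∈ K, ∀ y ∈ K, ‖x - y‖ ≤ D :=
    ⟨Metric.diam K, Metric.diam_nonneg, fun x hx y hy => by
      rw [← dist_eq_norm]; exact Metric.dist_le_diam_of_mem hK.isBounded hx hy⟩
  have hq : ∀ r, Measurable (Function.uncurry fun y x => ENNReal.ofReal (p y r x)) := fun r =>
    (hpmeas.comp (measurable_fst.prodMk (measurable_const.prodMk measurable_snd))).ennreal_ofReal
  have hq1 : ∀ r ∈ Set.Ioc t₀ T, ∀ y ∈ K, ∫⁻ x in K, ENNReal.ofReal (p y r x) = 1 := by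
    intro r hr y hy
    have hi : Integrable (fun x => p y r x) (volume.restrict K) := by
      by_contra hi
      have := hpint y hy r hr
      rw [integral_undef hi] at this
      exact zero_ne_one this
    rw [← ofReal_integral_eq_lintegral_ofReal hi (.of_forall fun x => hpnn y r x),
      hpint y hy r hr, ENNReal.ofReal_one]
  have hq1' : ∀ r ∈ Set.Ioc t₀ T, ∀ᵐ y ∂μ₀, ∫⁻ x in K, ENNReal.ofReal (p y r x) = 1 :=
    fun r hr => hμ₀ae.mono (hq1 r hr)
  have hbd : ∀ y ∈ K, ∀ x ∈ K, ∀ r ∈ Set.Ioc t₀ T, p y r x ≤ κ₁ * (r - t₀) ^ (-(d : ℝ) / 2) := by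
    intro y hy x hx r hr
    have hr0 : 0 < r - t₀ := sub_pos.2 hr.1
    refine (hpbd y hy x hx r hr).trans (mul_le_of_le_one_right (by positivity) ?_)
    rw [Real.exp_le_one_iff, neg_mul, neg_div, neg_nonpos]
    positivity
  have hdens : ∀ r ∈ Set.Ioc t₀ T, μ r = (volume.restrict K).withDensity
      (fun x => ∫⁻ y, ENNReal.ofReal (p y r x) ∂μ₀) := by
    intro r hr
    rw [hμ r hr, hres]
    refine withDensity_congr_ae ?_
    filter_upwards [ae_restrict_mem hKm] with x hx
    refine ofReal_integral_eq_lintegral_ofReal ?_ (.of_forall fun y => hpnn y r x)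
    refine Integrable.of_bound (C := κ₁ * (r - t₀) ^ (-(d : ℝ) / 2))
      (hpmeas.comp (measurable_id.prodMk (measurable_const (a := (r, x))))).aestronglyMeasurable ?_
    filter_upwards [hμ₀ae] with y hy
    rw [Real.norm_of_nonneg (hpnn y r x)]
    exact hbd y hy x hx r hr
  have hgm : ∀ r, Measurable fun x => ∫⁻ y, ENNReal.ofReal (p y r x) ∂μ₀ := fun r =>
    (hq r).lintegral_prod_left'
  have hg1 : ∀ r ∈ Set.Ioc t₀ T,
      ∫⁻ x in K, ∫⁻ y, ENNReal.ofReal (p y r x) ∂μ₀ = 1 := by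
    intro r hr
    rw [lintegral_lintegral_swap (f := fun x y => ENNReal.ofReal (p y r x))
      ((hq r).comp measurable_swap).aemeasurable,
      lintegral_congr_ae (hq1' r hr)]
    simp
  intro s hs
  rcases hs.1.eq_or_lt with rfl | hs0
  · have hcost : ∀ ε : ℝ, 0 < ε → ∀ r ∈ Set.Ioc t₀ T,
        ∫⁻ z, ‖z.1 - z.2‖ₑ ∂((volume.restrict K).prod μ₀).withDensity
          (fun z => ENNReal.ofReal (p z.2 r z.1)) ≤ ENNReal.ofReal ε +
        ENNReal.ofReal (D * κ₁ * ((r - t₀) ^ (-((d : ℝ) / 2)) *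
          Real.exp (-(κ₂ * ε ^ 2) / (r - t₀)))) * volume K := by
      intro ε hε r hr
      have hr0 : 0 < r - t₀ := sub_pos.2 hr.1
      have hqm : Measurable fun z : EuclideanSpace ℝ (Fin d) × EuclideanSpace ℝ (Fin d) =>
        ENNReal.ofReal (p z.2 r z.1) := (hq r).comp measurable_swap
      rw [lintegral_withDensity_eq_lintegral_mul _ hqm (by fun_prop)]
      simp only [Pi.mul_apply]
      have hcm : Measurable fun z : EuclideanSpace ℝ (Fin d) × EuclideanSpace ℝ (Fin d) =>
          ENNReal.ofReal (p z.2 r z.1) * ‖z.1 - z.2‖ₑ :=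
        hqm.mul (measurable_fst.sub measurable_snd).enorm
      rw [lintegral_prod_symm _ hcm.aemeasurable]
      set b := D * κ₁ * ((r - t₀) ^ (-((d : ℝ) / 2)) * Real.exp (-(κ₂ * ε ^ 2) / (r - t₀)))
        with hb
      have hb0 : 0 ≤ b := by positivity
      have hpt : ∀ y ∈ K, ∀ x ∈ K, p y r x * ‖x - y‖ ≤ ε * p y r x + b := by
        intro y hy x hx
        rcases le_or_gt ‖x - y‖ ε with h | h
        · nlinarith [mul_le_mul_of_nonneg_left h (hpnn y r x)]
        · have h1 : p y r x ≤ κ₁ * ((r - t₀) ^ (-((d : ℝ) / 2)) *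
              Real.exp (-(κ₂ * ε ^ 2) / (r - t₀))) := by
            refine (hpbd y hy x hx r hr).trans ?_
            rw [mul_assoc, neg_div, neg_mul]
            gcongr
          have h2 := mul_le_mul h1 (hD x hx y hy) (norm_nonneg _) (by positivity)
          have h3 := mul_nonneg hε.le (hpnn y r x)
          rw [hb]
          linarith
      calc ∫⁻ y, ∫⁻ x in K, ENNReal.ofReal (p y r x) * ‖x - y‖ₑ ∂volume ∂μ₀
          ≤ ∫⁻ y, (ENNReal.ofReal ε + ENNReal.ofReal b * volume K) ∂μ₀ := by
            refine lintegral_mono_ae ?_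
            filter_upwards [hμ₀ae] with y hy
            calc ∫⁻ x in K, ENNReal.ofReal (p y r x) * ‖x - y‖ₑ
                ≤ ∫⁻ x in K, (ENNReal.ofReal ε * ENNReal.ofReal (p y r x)
                    + ENNReal.ofReal b) := by
                  refine setLIntegral_mono' hKm fun x hx => ?_
                  rw [← ofReal_norm, ← ENNReal.ofReal_mul (hpnn y r x),
                    ← ENNReal.ofReal_mul hε.le,
                    ← ENNReal.ofReal_add (mul_nonneg hε.le (hpnn y r x)) hb0]
                  exact ENNReal.ofReal_le_ofReal (hpt y hy x hx)
              _ = ENNReal.ofReal ε + ENNReal.ofReal b * volume K := by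
                  rw [lintegral_add_right _ measurable_const,
                    lintegral_const_mul' _ _ ENNReal.ofReal_ne_top, hq1 r hr y hy,
                    setLIntegral_const, mul_one]
        _ = _ := by simp
    refine tendsto_wasserstein_one_zero (c := fun r => ∫⁻ z, ‖z.1 - z.2‖ₑ
      ∂((volume.restrict K).prod μ₀).withDensity (fun z => ENNReal.ofReal (p z.2 r z.1))) ?_ ?_
    · rw [ENNReal.tendsto_nhds_zero]
      intro η hη
      obtain ⟨ε, hε0, hε⟩ : ∃ ε : ℝ, 0 < ε ∧ ENNReal.ofReal ε < η := by
        obtain ⟨e, he0, he⟩ := ENNReal.lt_iff_exists_nnreal_btwn.1 hη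
        exact ⟨e, by exact_mod_cast he0, by simpa using he⟩
      have hsub : Tendsto (fun r => r - t₀) (𝓝[Set.Ioc t₀ T] t₀) (𝓝[>] 0) := by
        refine tendsto_nhdsWithin_iff.2 ⟨?_, ?_⟩
        · exact ((continuous_id.sub continuous_const).tendsto' t₀ 0 (by simp)).mono_left
            nhdsWithin_le_nhds
        · filter_upwards [self_mem_nhdsWithin] with r hr using sub_pos.2 hr.1
      have hlim := (tendsto_rpow_mul_exp_neg_div_nhdsGT_zero ((d : ℝ) / 2)
        (b := κ₂ * ε ^ 2) (by positivity)).comp hsub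
      have hlim2 := ENNReal.Tendsto.mul_const
        (ENNReal.tendsto_ofReal (hlim.const_mul (D * κ₁))) (b := volume K) (Or.inr hvol)
      have hlim3 := hlim2.const_add (ENNReal.ofReal ε)
      simp only [mul_zero, ENNReal.ofReal_zero, zero_mul, add_zero] at hlim3
      filter_upwards [hlim3.eventually_lt_const hε, self_mem_nhdsWithin] with r h1 hr
      exact (hcost ε hε0 r hr).trans h1.le
    · filter_upwards [self_mem_nhdsWithin] with r hr
      refine ⟨_, ?_, le_rfl⟩
      rw [hμt₀, hdens r hr]
      exact isCoupling_withDensity_kernel (hq r) (hq1' r hr)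
  · have hsT : s ∈ Set.Ioc t₀ T := ⟨hs0, hs.2.le⟩
    have hsub : Set.Ioc s T ⊆ Set.Ioc t₀ T := Set.Ioc_subset_Ioc_left hs0.le
    have hg : ∀ x ∈ K, Tendsto (fun r => ∫⁻ y, ENNReal.ofReal (p y r x) ∂μ₀)
        (𝓝[Set.Ioc s T] s) (𝓝 (∫⁻ y, ENNReal.ofReal (p y s x) ∂μ₀)) := by
      intro x hx
      refine tendsto_lintegral_filter_of_dominated_convergence
        (fun _ => ENNReal.ofReal (κ₁ * (s - t₀) ^ (-(d : ℝ) / 2)))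
        (.of_forall fun r => (hq r).comp (measurable_id.prodMk measurable_const)) ?_ (by simp) ?_
      · filter_upwards [self_mem_nhdsWithin] with r hr
        filter_upwards [hμ₀ae] with y hy
        refine ENNReal.ofReal_le_ofReal ((hbd y hy x hx r (hsub hr)).trans ?_)
        refine mul_le_mul_of_nonneg_left ?_ hκ₁.le
        refine Real.rpow_le_rpow_of_nonpos (sub_pos.2 hs0) (by linarith [hr.1]) ?_
        rw [neg_div, neg_nonpos]
        positivity
      · exact .of_forall fun y => ENNReal.tendsto_ofReal
          (((hpderiv y x s hsT).continuousWithinAt).mono hsub)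
    have hgfin : ∀ x ∈ K, ∫⁻ y, ENNReal.ofReal (p y s x) ∂μ₀ ≠ ⊤ := by
      intro x hx
      refine ((lintegral_mono_ae (hμ₀ae.mono fun y hy =>
        ENNReal.ofReal_le_ofReal (hbd y hy x hx s hsT))).trans_lt ?_).ne
      simp
    have hTV : Tendsto (fun r => ∫⁻ x in K, (∫⁻ y, ENNReal.ofReal (p y s x) ∂μ₀) -
        ∫⁻ y, ENNReal.ofReal (p y r x) ∂μ₀) (𝓝[Set.Ioc s T] s) (𝓝 0) := by
      have h0 : (0 : ℝ≥0∞) = ∫⁻ x in K, 0 := by simp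
      rw [h0]
      refine tendsto_lintegral_filter_of_dominated_convergence
        (fun x => ∫⁻ y, ENNReal.ofReal (p y s x) ∂μ₀)
        (.of_forall fun r => (hgm s).sub (hgm r))
        (.of_forall fun r => .of_forall fun x => tsub_le_self) (by simp [hg1 s hsT]) ?_
      filter_upwards [ae_restrict_mem hKm] with x hx
      have := ENNReal.Tendsto.sub tendsto_const_nhds (hg x hx) (Or.inl (hgfin x hx))
      rwa [tsub_self] at this
    have hDae : ∀ᵐ z ∂(volume.restrict K).prod (volume.restrict K),
        ‖z.1 - z.2‖ₑ ≤ ENNReal.ofReal D := by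
      rw [Measure.prod_restrict]
      filter_upwards [ae_restrict_mem (hKm.prod hKm)] with z hz
      rw [← ofReal_norm]
      exact ENNReal.ofReal_le_ofReal (hD _ hz.1 _ hz.2)
    refine tendsto_wasserstein_one_zero
      (by simpa using ENNReal.Tendsto.const_mul hTV (Or.inr (ENNReal.ofReal_ne_top (r := D)))) ?_
    filter_upwards [self_mem_nhdsWithin] with r hr
    rw [hdens r (hsub hr), hdens s hsT]
    exact exists_isCoupling_withDensity (hgm r) (hgm s) (hg1 r (hsub hr)) (hg1 s hsT) hDae
end
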